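/- Let p be a prime, k ≥ 1, and q = p^k. For all integers A and B with (q−1)^2 dividing A and B ≡ A (mod q), the integer A·B^(q−1) is an integer group determinant of GA(1,q). -/

import Mathlib

/-- The group determinant of a family of integers indexed by a finite group `G`:
`det (a (g * h⁻¹))`. -/
noncomputable def groupDet (G : Type*) [Group G] [Finite G] (a : G → ℤ) : ℤ :=
  letI : Fintype G := Fintype.ofFinite G
  letI : DecidableEq G := Classical.decEq G
  Matrix.det (Matrix.of fun g h : G => a (g * h⁻¹))

/-- `D` is an integer group determinant of the finite group `G`. -/
def IsIntGroupDet (G : Type*) [Group G] [Finite G] (D : ℤ) : Prop :=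
  ∃ a : G → ℤ, groupDet G a = D

/-- `D` is a `ℤ_m` integer group determinant: a determinant of an integer circulant
matrix `(a_{(i-j) mod m})`. -/
def IsCirculantDet (m : ℕ) (D : ℤ) : Prop :=
  ∃ a : Fin m → ℤ, (Matrix.circulant a).det = D

/-- The action of `F_q^×` on the additive group of `F_q` by multiplication, as a
homomorphism to the automorphism group of `Multiplicative F_q`. -/
noncomputable def GAaction (p k : ℕ) [Fact p.Prime] :
    (GaloisField p k)ˣ →* MulAut (Multiplicative (GaloisField p k)) where
  toFun u :=
    { toFun := fun x => Multiplicative.ofAdd (u • x.toAdd)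
      invFun := fun x => Multiplicative.ofAdd (u⁻¹ • x.toAdd)
      left_inv := fun x => by simp
      right_inv := fun x => by simp
      map_mul' := fun x y => by
        simp [toAdd_mul, smul_add, ofAdd_add] }
  map_one' := by
    ext x
    simp
  map_mul' u v := by
    ext x
    simp [mul_smul]

instance {N G : Type*} [Group N] [Group G] {φ : G →* MulAut N} [Finite N] [Finite G] :
    Finite (N ⋊[φ] G) :=
  Finite.of_equiv (N × G)
    ⟨fun x => ⟨x.1, x.2⟩, fun x => (x.left, x.right), fun _ => rfl, fun _ => rfl⟩

/-- `GA(1,q)` for `q = p^k`: the semidirect product `F_q ⋊ F_q^×`. -/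
abbrev GA1 (p k : ℕ) [Fact p.Prime] :=
  Multiplicative (GaloisField p k) ⋊[GAaction p k] (GaloisField p k)ˣ

/-- The permutation matrix of left multiplication by `γ`. -/
def shiftMatrix (R : Type*) [CommRing R] {U : Type*} [Group U] [DecidableEq U] (γ : U) :
    Matrix U U R :=
  Matrix.of fun u v => if u = γ * v then 1 else 0

theorem shiftMatrix_mul_apply {R ι U : Type*} [CommRing R] [Group U] [Fintype U]
    [DecidableEq U] (γ : U) (M : Matrix U ι R) (u : U) (i : ι) :
    (shiftMatrix R γ * M) u i = M (γ⁻¹ * u) i := by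
  simp only [shiftMatrix, Matrix.mul_apply, Matrix.of_apply]
  rw [Finset.sum_eq_single (γ⁻¹ * u)]
  · simp
  · intro b _ hb
    rw [if_neg, zero_mul]
    rintro rfl
    simp at hb
  · simp

theorem shiftMatrix_pow {R U : Type*} [CommRing R] [Group U] [Fintype U]
    [DecidableEq U] (γ : U) (i : ℕ) : shiftMatrix R γ ^ i = shiftMatrix R (γ ^ i) := by
  induction i with
  | zero => ext u v; simp [shiftMatrix, Matrix.one_apply]
  | succ i ih =>
    ext u v
    rw [pow_succ', ih, shiftMatrix_mul_apply]
    simp [shiftMatrix, pow_succ', inv_mul_eq_iff_eq_mul, mul_assoc]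

theorem shiftMatrix_pow_card {R U : Type*} [CommRing R] [Group U] [Fintype U]
    [DecidableEq U] (γ : U) : shiftMatrix R γ ^ Fintype.card U = 1 := by
  rw [shiftMatrix_pow, pow_card_eq_one]
  ext u v
  simp [shiftMatrix, Matrix.one_apply]

open Polynomial in
theorem charpoly_shiftMatrix {R U : Type*} [CommRing R] [Nontrivial R] [Group U] [Fintype U]
    [DecidableEq U] {γ : U} (hγ : orderOf γ = Fintype.card U) :
    (shiftMatrix R γ).charpoly = X ^ Fintype.card U - 1 := by
  set P := shiftMatrix R γ
  have hpos : Fintype.card U ≠ 0 := Fintype.card_ne_zero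
  have hmonic : (X ^ Fintype.card U - 1 : R[X]).Monic := monic_X_pow_sub_C 1 hpos
  have hdegX : (X ^ Fintype.card U - 1 : R[X]).degree = Fintype.card U :=
    degree_X_pow_sub_C (Nat.pos_of_ne_zero hpos) 1
  have hdeg : (P.charpoly - (X ^ Fintype.card U - 1)).degree < (Fintype.card U : WithBot ℕ) := by
    rw [← hdegX, ← neg_sub, degree_neg]
    refine degree_sub_lt_left ?_ hmonic.ne_zero ?_
    · rw [P.charpoly_degree_eq_dim, hdegX]
    · rw [P.charpoly_monic.leadingCoeff, hmonic.leadingCoeff]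
  have haeval : aeval P (P.charpoly - (X ^ Fintype.card U - 1)) = 0 := by
    simp [Matrix.aeval_self_charpoly, P, shiftMatrix_pow_card]
  rw [← sub_eq_zero]
  by_contra hne
  rw [aeval_eq_sum_range' ((natDegree_lt_iff_degree_lt hne).2 hdeg)] at haeval
  apply hne
  ext j
  rw [coeff_zero]
  by_cases hj : j < Fintype.card U
  · have hpow (i : ℕ) : (P ^ i) (γ ^ j) 1 = if γ ^ j = γ ^ i then 1 else 0 := by
      rw [shiftMatrix_pow]
      simp [shiftMatrix]
    have h := congrFun₂ haeval (γ ^ j) 1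
    rw [Matrix.sum_apply, Finset.sum_eq_single j] at h
    · simpa [hpow] using h
    · intro i hi hij
      have : γ ^ j ≠ γ ^ i := fun h => hij <|
        pow_injOn_Iio_orderOf (by simpa [hγ] using hi) (by simpa [hγ] using hj) h.symm
      simp [hpow, this]
    · simp [hj]
  · exact coeff_eq_zero_of_degree_lt (hdeg.trans_le (by exact_mod_cast not_lt.1 hj))

theorem det_smul_one_sub_shiftMatrix {R U : Type*} [CommRing R] [Nontrivial R] [Group U]
    [Fintype U] [DecidableEq U] {γ : U} (hγ : orderOf γ = Fintype.card U) (t : R) :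
    (t • 1 - shiftMatrix R γ).det = t ^ Fintype.card U - 1 := by
  have h := (shiftMatrix R γ).eval_charpoly t
  rw [charpoly_shiftMatrix hγ] at h
  rw [Matrix.smul_one_eq_diagonal]
  simpa using h.symm

theorem det_smul_one_add_const {R n : Type*} [CommRing R] [Fintype n] [DecidableEq n] [Nonempty n]
    (x y : R) :
    (x • (1 : Matrix n n R) + Matrix.of fun _ _ => y).det =
      x ^ (Fintype.card n - 1) * (x + Fintype.card n * y) := by
  have h := (Matrix.vecMulVec (fun _ : n => -y) (fun _ => (1 : R))).eval_charpoly x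
  rw [Matrix.charpoly_vecMulVec] at h
  have e : x • (1 : Matrix n n R) + Matrix.of (fun _ _ => y) =
      Matrix.scalar n x - Matrix.vecMulVec (fun _ : n => -y) (fun _ => (1 : R)) := by
    ext i j
    simp [Matrix.vecMulVec_apply, Matrix.smul_one_eq_diagonal]
  rw [e, ← h]
  obtain ⟨k, hk⟩ := Nat.exists_eq_succ_of_ne_zero (Fintype.card_ne_zero (α := n))
  simp [hk, dotProduct]
  ring

/-- The coefficients of the adjugate `∑ i, t ^ i γ ^ (|U| - 1 - i)` of `t - γ`. -/
def geomKernel {R U : Type*} [CommRing R] [Group U] [Fintype U] [DecidableEq U]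
    (γ : U) (t : R) (w : U) : R :=
  ∑ i ∈ Finset.range (Fintype.card U), t ^ i * if w = γ ^ (Fintype.card U - 1 - i) then 1 else 0

theorem smul_one_sub_shiftMatrix_mul_geomKernel {R U : Type*} [CommRing R] [Group U]
    [Fintype U] [DecidableEq U] (γ : U) (t : R) :
    (t • 1 - shiftMatrix R γ) * Matrix.of (fun u v => geomKernel γ t (u * v⁻¹)) =
      (t ^ Fintype.card U - 1) • 1 := by
  have h := (((Commute.one_left (shiftMatrix R γ)).smul_left t).mul_geom_sum₂ (Fintype.card U))
  rw [shiftMatrix_pow_card, smul_pow, one_pow] at h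
  rw [sub_smul, one_smul, ← h]
  congr 1
  ext u v
  simp only [geomKernel, Matrix.sum_apply, smul_pow, shiftMatrix_pow]
  simp [shiftMatrix, mul_inv_eq_iff_eq_mul]

theorem geomKernel_one {R U : Type*} [CommRing R] [Group U] [Fintype U] [DecidableEq U]
    {γ : U} (hγ : orderOf γ = Fintype.card U) (w : U) : geomKernel γ (1 : R) w = 1 := by
  simp only [geomKernel, one_pow, one_mul]
  rw [Finset.sum_range_reflect (fun i => if w = γ ^ i then (1 : R) else 0)]
  have hw : w ∈ Submonoid.powers γ := by
    have := Subgroup.eq_top_of_card_eq (Subgroup.zpowers γ) (by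
      rw [Nat.card_zpowers, hγ, Nat.card_eq_fintype_card])
    rw [mem_powers_iff_mem_zpowers, this]
    trivial
  rw [mem_powers_iff_mem_range_orderOf, hγ] at hw
  obtain ⟨j, hj, rfl⟩ := Finset.mem_image.1 hw
  rw [Finset.sum_eq_single j _ (fun h => absurd hj h), if_pos rfl]
  intro i hi hij
  refine if_neg fun h => hij ?_
  exact pow_injOn_Iio_orderOf (by simpa [hγ] using hi) (by simpa [hγ] using hj) h.symm

theorem Fintype.sum_units_add {F M : Type*} [Field F] [Fintype F] [DecidableEq F] [AddCommMonoid M]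
    (f : F → M) : f 0 + ∑ u : Fˣ, f u = ∑ x, f x := by
  rw [Fintype.sum_eq_add_sum_compl (0 : F)]
  congr 1
  refine Finset.sum_bij (fun u _ => (u : F)) ?_ ?_ ?_ ?_
  · simp
  · intro a _ b _ h
    exact Units.ext h
  · intro b hb
    exact ⟨Units.mk0 b (by simpa using hb), Finset.mem_univ _, rfl⟩
  · simp

theorem sum_units_affine {F R : Type*} [Field F] [Fintype F] [DecidableEq F] [CommRing R]
    (m : F → R) (w : Fˣ) (d : F) :
    ∑ u : Fˣ, m (w * (u * d + 1)) =
      if d = 0 then (Fintype.card Fˣ : R) * m w else ∑ x, m x - m w := by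
  split_ifs with hd
  · simp [hd]
  · have h := Fintype.sum_units_add fun x : F => m (w * (x * d + 1))
    have e : ∑ x, m (w * (x * d + 1)) = ∑ x, m x :=
      Function.Bijective.sum_comp (g := m) (e := fun x : F => (w : F) * (x * d + 1))
        (Finite.injective_iff_bijective.1 fun x y h => by simpa [hd] using h)
    rw [← e, ← h]
    simp

/-- The matrix of left multiplication by `t - γ + ∑ x, m x • (x, 1) * ∑ u, (0, u) * (-1, 1)` on the
group ring of `F ⋊ Fˣ`, in the coordinates `(z, u) ↦ (u z, u)`. -/
def affineMatrix {F R : Type*} [Field F] [DecidableEq F] [CommRing R]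
    (m : F → R) (γ : Fˣ) (t : R) : Matrix (F × Fˣ) (F × Fˣ) R :=
  Matrix.kroneckerMap (fun x y => x * y) 1 (t • 1 - shiftMatrix R γ) +
    Matrix.of fun g h => m (g.2 * (g.1 - (h.1 - (h.2⁻¹ : Fˣ))))

theorem det_affineMatrix_of_ne {F K : Type*} [Field F] [Fintype F] [DecidableEq F] [Field K]
    (m : F → K) {γ : Fˣ} (hγ : orderOf γ = Fintype.card Fˣ) {t : K}
    (ht : t ^ Fintype.card Fˣ - 1 ≠ 0) :
    (affineMatrix m γ t).det =
      (t ^ Fintype.card Fˣ - 1 + (Fintype.card F * ∑ w, geomKernel γ t w * m (w⁻¹ : Fˣ) -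
        (∑ x, m x) * ∑ w, geomKernel γ t w)) ^ (Fintype.card F - 1) *
      (t ^ Fintype.card Fˣ - 1 +
        Fintype.card Fˣ * (∑ x, m x) * ∑ w, geomKernel γ t w) := by
  set s := t ^ Fintype.card Fˣ - 1 with hs
  set A : Matrix (F × Fˣ) (F × Fˣ) K :=
    Matrix.kroneckerMap (fun x y => x * y) 1 (t • 1 - shiftMatrix K γ) with hA
  set C : Matrix (F × Fˣ) (F × Fˣ) K :=
    Matrix.kroneckerMap (fun x y => x * y) 1
      (Matrix.of fun u v => geomKernel γ t (u * v⁻¹)) with hC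
  let V : Matrix (F × Fˣ) F K := Matrix.of fun g z => m (g.2 * (g.1 - z))
  let Q : Matrix F (F × Fˣ) K := Matrix.of fun z g => if g.1 - (g.2⁻¹ : Fˣ) = z then 1 else 0
  have hM : affineMatrix m γ t = A + V * Q := by
    rw [affineMatrix, hA]
    congr 1
    ext g h
    simp [V, Q, Matrix.mul_apply]
  have hdetA : A.det = s ^ Fintype.card F := by
    rw [hA, Matrix.det_kronecker, det_smul_one_sub_shiftMatrix hγ]
    simp [hs]
  have hinv : A⁻¹ = s⁻¹ • C := by
    apply Matrix.inv_eq_right_inv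
    rw [Matrix.mul_smul, hA, hC, ← Matrix.mul_kronecker_mul,
      smul_one_sub_shiftMatrix_mul_geomKernel, ← hs, Matrix.kronecker_smul, smul_smul,
      inv_mul_cancel₀ ht]
    simp
  have hcard : (Fintype.card F : K) = Fintype.card Fˣ + 1 := by
    rw [Fintype.card_units, Nat.cast_sub Fintype.card_pos]
    simp
  have hQCV : s • (1 : Matrix F F K) + Q * C * V =
      (s + (Fintype.card F * ∑ w, geomKernel γ t w * m (w⁻¹ : Fˣ) -
        (∑ x, m x) * ∑ w, geomKernel γ t w)) • 1 + Matrix.of fun _ _ =>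
      (∑ x, m x) * ∑ w, geomKernel γ t w - ∑ w, geomKernel γ t w * m (w⁻¹ : Fˣ) := by
    ext z z'
    have hCV : ∀ g : F × Fˣ, (C * V) g z' =
        ∑ w, geomKernel γ t w * m ((w⁻¹ : Fˣ) * (g.2 * (g.1 - z'))) := by
      intro g
      rw [Matrix.mul_apply, Fintype.sum_prod_type, Finset.sum_eq_single g.1]
      · rw [← (Equiv.divLeft g.2).sum_comp]
        refine Finset.sum_congr rfl fun w _ => ?_
        simp [C, V, Matrix.kroneckerMap_apply, div_eq_mul_inv, mul_assoc, mul_left_comm]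
      · intro a _ ha
        simp [C, Matrix.one_apply_ne ha.symm]
      · simp
    have key : (Q * C * V) z z' = ∑ w, geomKernel γ t w *
        if z - z' = 0 then (Fintype.card Fˣ : K) * m (w⁻¹ : Fˣ)
        else ∑ x, m x - m (w⁻¹ : Fˣ) := by
      rw [Matrix.mul_assoc, Matrix.mul_apply, Fintype.sum_prod_type, Finset.sum_comm]
      simp_rw [hCV, ← sum_units_affine, Finset.mul_sum]
      rw [Finset.sum_comm (f := fun w u => geomKernel γ t w * _)]
      refine Finset.sum_congr rfl fun u _ => ?_
      rw [Finset.sum_eq_single (z + (u⁻¹ : Fˣ))]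
      · simp [Q, add_sub_right_comm, mul_add]
      · intro a _ ha
        have hQ : Q z (a, u) = 0 := if_neg fun h => ha (sub_eq_iff_eq_add.1 h)
        simp [hQ]
      · simp
    rw [Matrix.add_apply, key]
    by_cases h : z = z'
    · subst h
      simp [hcard, mul_left_comm _ (Fintype.card Fˣ : K), ← Finset.mul_sum]
      ring
    · simp [h, sub_eq_zero, mul_sub, Finset.mul_sum, mul_comm]
  rw [hM, Matrix.det_add_mul _ _ (by rw [hdetA]; exact (pow_ne_zero _ ht).isUnit), hdetA, hinv,
    ← Matrix.det_smul, smul_add, Matrix.mul_smul, Matrix.smul_mul, smul_smul, mul_inv_cancel₀ ht,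
    one_smul, hQCV, det_smul_one_add_const]
  congr 1
  rw [hcard]
  ring

theorem det_affineMatrix_one {F : Type*} [Field F] [Fintype F] [DecidableEq F]
    (m : F → ℝ) {γ : Fˣ} (hγ : orderOf γ = Fintype.card Fˣ) :
    (affineMatrix m γ 1).det =
      (Fintype.card Fˣ : ℝ) ^ 2 * (∑ x, m x) *
        (∑ x, m x - Fintype.card F * m 0) ^ (Fintype.card F - 1) := by
  let lhs : ℝ → ℝ := fun t => (affineMatrix m γ t).det
  let rhs : ℝ → ℝ := fun t =>
    (t ^ Fintype.card Fˣ - 1 + (Fintype.card F * ∑ w, geomKernel γ t w * m (w⁻¹ : Fˣ) -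
        (∑ x, m x) * ∑ w, geomKernel γ t w)) ^ (Fintype.card F - 1) *
      (t ^ Fintype.card Fˣ - 1 +
        Fintype.card Fˣ * (∑ x, m x) * ∑ w, geomKernel γ t w)
  have heq : Set.EqOn lhs rhs (Set.Ioi 1) := fun t ht =>
    det_affineMatrix_of_ne m hγ (sub_ne_zero.2 (one_lt_pow₀ ht Fintype.card_ne_zero).ne')
  have hlhs : Continuous lhs := by
    refine Continuous.matrix_det (continuous_matrix fun g h => ?_)
    simp only [affineMatrix, Matrix.add_apply, Matrix.kroneckerMap_apply, Matrix.sub_apply,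
      Matrix.smul_apply, smul_eq_mul]
    fun_prop
  have hrhs : Continuous rhs := by
    simp only [rhs, geomKernel]
    fun_prop
  have h1 := heq.closure hlhs hrhs (show (1 : ℝ) ∈ closure (Set.Ioi 1) by simp)
  have hcard : (Fintype.card F : ℝ) = Fintype.card Fˣ + 1 := by
    rw [Fintype.card_units, Nat.cast_sub Fintype.card_pos]
    simp
  have hsum : ∑ w : Fˣ, m (w⁻¹ : Fˣ) = ∑ x, m x - m 0 := by
    rw [← Fintype.sum_units_add m, add_sub_cancel_left]
    exact Equiv.sum_comp (Equiv.inv Fˣ) fun w : Fˣ => m w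
  simp only [lhs, rhs, geomKernel_one hγ, one_pow, one_mul, sub_self, zero_add, hsum,
    Finset.sum_const, Finset.card_univ, nsmul_eq_mul, mul_one] at h1
  rw [h1, mul_comm]
  congr 1
  · ring
  · rw [hcard]
    ring

theorem cast_groupDet_eq_det {G ι R : Type*} [Group G] [Finite G] [Fintype ι] [DecidableEq ι]
    [CommRing R] (e : ι ≃ G) (a : G → ℤ) :
    (groupDet G a : R) = (Matrix.of fun i j => (a (e i * (e j)⁻¹) : R)).det := by
  let : Fintype G := Fintype.ofFinite G
  let : DecidableEq G := Classical.decEq G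
  rw [groupDet, Int.cast_det, ← Matrix.det_submatrix_equiv_self e]
  rfl

/-- The coordinates `(z, u) ↦ (u z, u)` on `GA(1,q)`. -/
noncomputable def GA1.coordEquiv (p k : ℕ) [Fact p.Prime] :
    GaloisField p k × (GaloisField p k)ˣ ≃ GA1 p k where
  toFun g := ⟨Multiplicative.ofAdd (g.2 • g.1), g.2⟩
  invFun g := (g.right⁻¹ • g.left.toAdd, g.right)
  left_inv g := by simp
  right_inv g := by simp

theorem GA1.coordEquiv_apply (p k : ℕ) [Fact p.Prime]
    (g : GaloisField p k × (GaloisField p k)ˣ) :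
    GA1.coordEquiv p k g = ⟨Multiplicative.ofAdd (g.2 * g.1), g.2⟩ :=
  rfl

theorem GA1.coordEquiv_mul_inv (p k : ℕ) [Fact p.Prime]
    (g h : GaloisField p k × (GaloisField p k)ˣ) :
    GA1.coordEquiv p k g * (GA1.coordEquiv p k h)⁻¹ =
      ⟨Multiplicative.ofAdd (g.2 * (g.1 - h.1)), g.2 * h.2⁻¹⟩ := by
  ext
  · rw [SemidirectProduct.mul_left, SemidirectProduct.inv_left]
    simp [GA1.coordEquiv_apply, GAaction, Units.smul_def, mul_add, sub_eq_add_neg,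
      -SemidirectProduct.mk_eq_inl_mul_inr]
  · simp [GA1.coordEquiv_apply]

theorem isIntGroupDet_GA1 (p k : ℕ) [Fact p.Prime] [Fintype (GaloisField p k)]
    (m : GaloisField p k → ℤ) :
    IsIntGroupDet (GA1 p k)
      (((Fintype.card (GaloisField p k) : ℤ) - 1) ^ 2 * (∑ x, m x) *
        (∑ x, m x - Fintype.card (GaloisField p k) * m 0) ^
          (Fintype.card (GaloisField p k) - 1)) := by
  classical
  obtain ⟨γ, hγ⟩ := IsCyclic.exists_ofOrder_eq_natCard (α := (GaloisField p k)ˣ)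
  rw [Nat.card_eq_fintype_card] at hγ
  refine ⟨fun g => (if g = 1 then 1 else 0) - (if g = SemidirectProduct.inr γ then 1 else 0) +
    m (g.left.toAdd + g.right), ?_⟩
  rw [← Int.cast_inj (α := ℝ), cast_groupDet_eq_det (GA1.coordEquiv p k)]
  have hdet := det_affineMatrix_one (fun x => (m x : ℝ)) hγ
  rw [Fintype.card_units, Nat.cast_sub Fintype.card_pos] at hdet
  push_cast at hdet ⊢
  rw [← hdet]
  congr 1
  ext g h
  rw [Matrix.of_apply, GA1.coordEquiv_mul_inv]
  simp only [SemidirectProduct.ext_iff, affineMatrix, shiftMatrix, Matrix.add_apply,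
    Matrix.kroneckerMap_apply, Matrix.sub_apply, Matrix.of_apply, Matrix.one_apply, one_smul]
  congr 1
  · by_cases hz : g.1 = h.1
    · simp [hz, mul_inv_eq_iff_eq_mul]
    · simp [hz, sub_eq_zero]
  · simp [mul_sub, sub_add]

/-- If `(q-1)^2 ∣ A` and `B ≡ A (mod q)`, then `A * B^(q-1)` is an integer group
determinant of `GA(1,q)`. -/
theorem stmt2 (p k q : ℕ) [Fact p.Prime] (hk : 1 ≤ k) (hq : q = p ^ k)
    (A B : ℤ) (hA : ((q : ℤ) - 1) ^ 2 ∣ A) (hB : B ≡ A [ZMOD (q : ℤ)]) :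
    IsIntGroupDet (GA1 p k) (A * B ^ (q - 1)) := by
  classical
  let := Fintype.ofFinite (GaloisField p k)
  have hcard : Fintype.card (GaloisField p k) = q := by
    rw [← Nat.card_eq_fintype_card, GaloisField.card p k (by lia), hq]
  obtain ⟨n, rfl⟩ := hA
  obtain ⟨j, hj⟩ := hB.dvd
  obtain ⟨l, hl⟩ : ∃ l : ℤ, n - B = q * l := ⟨j - (q - 2) * n, by linear_combination hj⟩
  have h := isIntGroupDet_GA1 p k (Pi.single 0 l + Pi.single 1 (n - l))
  simp only [hcard, Pi.add_apply, Finset.sum_add_distrib, Finset.sum_pi_single', Finset.mem_univ,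
    if_true, Pi.single_eq_same, add_sub_cancel, add_zero,
    Pi.single_eq_of_ne (zero_ne_one (α := GaloisField p k))] at h
  rwa [← hl, sub_sub_cancel] at h
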